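/- With notation and hypotheses as in the context, B(e₃, e₃) = p^{2k}·c. -/

import Mathlib

open Matrix

/-- The matrix of the Hecke operator `U𝔭` in the basis
`[μ], υ𝔭*·[μ], υ𝔭̄*·[μ], υ𝔭*υ𝔭̄*·[μ]`. -/
noncomputable def Ufp (p k : ℕ) (lp : ℂ) : Matrix (Fin 4) (Fin 4) ℂ :=
  !![lp, (p : ℂ) ^ (k + 1), 0, 0;
     -1, 0, 0, 0;
     0, 0, lp, (p : ℂ) ^ (k + 1);
     0, 0, -1, 0]

/-- The matrix of the Hecke operator `U𝔭̄` in the same basis. -/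
noncomputable def Ufpb (p k : ℕ) (lpb : ℂ) : Matrix (Fin 4) (Fin 4) ℂ :=
  !![lpb, 0, (p : ℂ) ^ (k + 1), 0;
     0, lpb, 0, (p : ℂ) ^ (k + 1);
     -1, 0, 0, 0;
     0, -1, 0, 0]

/-- The matrix of the partial Atkin–Lehner operator `ω𝔭` (with `ε = (−1)^k`). -/
noncomputable def Wfp (p k : ℕ) : Matrix (Fin 4) (Fin 4) ℂ :=
  !![0, (p : ℂ) ^ k, 0, 0;
     (-1 : ℂ) ^ k, 0, 0, 0;
     0, 0, 0, (p : ℂ) ^ k;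
     0, 0, (-1 : ℂ) ^ k, 0]

/-- The matrix of the partial Atkin–Lehner operator `ω𝔭̄` (with `ε = (−1)^k`). -/
noncomputable def Wfpb (p k : ℕ) : Matrix (Fin 4) (Fin 4) ℂ :=
  !![0, 0, (p : ℂ) ^ k, 0;
     0, 0, 0, (p : ℂ) ^ k;
     (-1 : ℂ) ^ k, 0, 0, 0;
     0, (-1 : ℂ) ^ k, 0, 0]

/-- The Atkin–Lehner matrix `ω_p = ω𝔭·ω𝔭̄`. -/
noncomputable def Wp (p k : ℕ) : Matrix (Fin 4) (Fin 4) ℂ := Wfp p k * Wfpb p k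

/-- The adjoint `U𝔭* = ω_p⁻¹·U𝔭·ω_p`. -/
noncomputable def UfpStar (p k : ℕ) (lp : ℂ) : Matrix (Fin 4) (Fin 4) ℂ :=
  (Wp p k)⁻¹ * Ufp p k lp * Wp p k

/-- The adjoint `U𝔭̄* = ω_p⁻¹·U𝔭̄·ω_p`. -/
noncomputable def UfpbStar (p k : ℕ) (lpb : ℂ) : Matrix (Fin 4) (Fin 4) ℂ :=
  (Wp p k)⁻¹ * Ufpb p k lpb * Wp p k

/-- The standard basis `e₀, e₁, e₂, e₃` of `ℂ⁴`. -/
noncomputable def e (i : Fin 4) : Fin 4 → ℂ := Pi.single i 1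

/-- The Atkin–Lehner matrix `ω_p` is antidiagonal. -/
theorem Wp_eq (p k : ℕ) :
    Wp p k = !![0, 0, 0, (p : ℂ) ^ k * (p : ℂ) ^ k;
                0, 0, (p : ℂ) ^ k * (-1) ^ k, 0;
                0, (-1) ^ k * (p : ℂ) ^ k, 0, 0;
                (-1) ^ k * (-1) ^ k, 0, 0, 0] := by
  ext i j
  fin_cases i <;> fin_cases j <;>
    simp [Wp, Wfp, Wfpb, Matrix.mul_apply, Fin.sum_univ_four, mul_comm]

theorem neg_one_pow_mul_self (k : ℕ) : (-1 : ℂ) ^ k * (-1) ^ k = 1 := by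
  rw [← mul_pow]
  simp

theorem Wp_mul_self (p k : ℕ) : Wp p k * Wp p k = ((p : ℂ) ^ k * (p : ℂ) ^ k) • 1 := by
  have h := neg_one_pow_mul_self k
  rw [Wp_eq]
  ext i j
  fin_cases i <;> fin_cases j <;>
    simp [Matrix.mul_apply, Fin.sum_univ_four] <;>
    linear_combination (p : ℂ) ^ k * (p : ℂ) ^ k * h

theorem isUnit_det_Wp {p : ℕ} (hp : p ≠ 0) (k : ℕ) : IsUnit (Wp p k).det := by
  have hdet := congrArg Matrix.det (Wp_mul_self p k)
  rw [Matrix.det_mul, Matrix.det_smul, Matrix.det_one, mul_one] at hdet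
  refine isUnit_iff_ne_zero.mpr fun h => ?_
  have hq : (p : ℂ) ≠ 0 := Nat.cast_ne_zero.mpr hp
  rw [h, zero_mul] at hdet
  exact pow_ne_zero _ (mul_ne_zero (pow_ne_zero k hq) (pow_ne_zero k hq)) hdet.symm

theorem conj_mulVec_eq {n R : Type*} [Fintype n] [DecidableEq n] [CommRing R]
    {W U : Matrix n n R} (hW : IsUnit W.det) {x y : n → R}
    (h : U *ᵥ (W *ᵥ x) = W *ᵥ y) : (W⁻¹ * U * W) *ᵥ x = y := by
  rw [← Matrix.mulVec_mulVec, ← Matrix.mulVec_mulVec, h, Matrix.mulVec_mulVec,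
    Matrix.nonsing_inv_mul W hW, Matrix.one_mulVec]

theorem Ufp_mulVec_e_two (p k : ℕ) (l : ℂ) :
    Ufp p k l *ᵥ e 2 = l • e 2 + (-1 : ℂ) • e 3 := by
  ext i
  fin_cases i <;> simp [Ufp, e]

theorem Ufpb_mulVec_e_zero (p k : ℕ) (l : ℂ) :
    Ufpb p k l *ᵥ e 0 = l • e 0 + (-1 : ℂ) • e 2 := by
  ext i
  fin_cases i <;> simp [Ufpb, e]

theorem UfpStar_mulVec_e_three {p : ℕ} (hp : p ≠ 0) (k : ℕ) (l : ℂ) :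
    UfpStar p k l *ᵥ e 3 = (-((-1) ^ k * (p : ℂ) ^ k)) • e 2 + l • e 3 := by
  refine conj_mulVec_eq (isUnit_det_Wp hp k) ?_
  have h := neg_one_pow_mul_self k
  rw [Wp_eq]
  ext i
  fin_cases i <;> simp [Ufp, e, Matrix.mulVec, dotProduct, Fin.sum_univ_four]
  · ring
  · linear_combination -(p : ℂ) ^ k * (p : ℂ) ^ k * h

theorem UfpbStar_mulVec_e_two {p : ℕ} (hp : p ≠ 0) (k : ℕ) (l : ℂ) :
    UfpbStar p k l *ᵥ e 2 = (-((-1) ^ k * (p : ℂ) ^ k)) • e 0 + l • e 2 := by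
  refine conj_mulVec_eq (isUnit_det_Wp hp k) ?_
  have h := neg_one_pow_mul_self k
  rw [Wp_eq]
  ext i
  fin_cases i <;> simp [Ufpb, e, Matrix.mulVec, dotProduct, Fin.sum_univ_four]
  · ring
  · linear_combination -(-1 : ℂ) ^ k * (p : ℂ) ^ k * h

/-- Value of the twisted Poincaré pairing: `B(e₃,e₃) = p^{2k}·c`, `c = B(e₀,e₀)`. -/
theorem stmt_12 (p k : ℕ) (hp : p.Prime) (hp3 : 3 ≤ p) (lp lpb : ℝ)
    (B : (Fin 4 → ℂ) → (Fin 4 → ℂ) → ℂ)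
    (haddl : ∀ x x' y, B (x + x') y = B x y + B x' y)
    (haddr : ∀ x y y', B x (y + y') = B x y + B x y')
    (hsmull : ∀ (a : ℂ) (x y : Fin 4 → ℂ), B (a • x) y = a * B x y)
    (hsmulr : ∀ (a : ℂ) (x y : Fin 4 → ℂ), B x (a • y) = (starRingEnd ℂ) a * B x y)
    (hU : ∀ x y, B ((Ufp p k (lp : ℂ)).mulVec x) y = B x ((UfpStar p k (lp : ℂ)).mulVec y))
    (hUs : ∀ x y, B ((UfpStar p k (lp : ℂ)).mulVec x) y = B x ((Ufp p k (lp : ℂ)).mulVec y))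
    (hV : ∀ x y, B ((Ufpb p k (lpb : ℂ)).mulVec x) y = B x ((UfpbStar p k (lpb : ℂ)).mulVec y))
    (hVs : ∀ x y, B ((UfpbStar p k (lpb : ℂ)).mulVec x) y = B x ((Ufpb p k (lpb : ℂ)).mulVec y))
    :
    B (e 3) (e 3) = (p : ℂ) ^ (2 * k) * B (e 0) (e 0) := by
  have hp0 := hp.ne_zero
  have h := neg_one_pow_mul_self k
  have h23 := hU (e 2) (e 3)
  have h02 := hV (e 0) (e 2)
  rw [Ufp_mulVec_e_two, UfpStar_mulVec_e_three hp0] at h23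
  rw [Ufpb_mulVec_e_zero, UfpbStar_mulVec_e_two hp0] at h02
  simp only [haddl, haddr, hsmull, hsmulr, map_neg, map_mul, map_pow, map_one, map_natCast,
    Complex.conj_ofReal] at h23 h02
  linear_combination -h23 - (-1) ^ k * (p : ℂ) ^ k * h02 +
    (p : ℂ) ^ (2 * k) * B (e 0) (e 0) * h
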